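/- Let (W,S) be an irreducible, infinite, non-affine Coxeter system of finite rank and let G be a subgroup of W of finite index. Then the center of G is trivial. -/

import Mathlib

namespace CoxeterPaper

/-- The entry `-cos (π / m i j)` of the matrix of the standard bilinear form,
interpreted as `-1` when `m i j = ∞` (encoded as `0`). -/
noncomputable def formEntry {B : Type*} (M : CoxeterMatrix B) (i j : B) : ℝ :=
  if M i j = 0 then -1 else - Real.cos (Real.pi / (M i j : ℝ))

/-- The standard bilinear form associated to a Coxeter matrix, on `V = B → ℝ`
(with basis `{α_s : s ∈ S}` identified with the standard basis). -/
noncomputable def bilin {B : Type*} [Fintype B] (M : CoxeterMatrix B) (v w : B → ℝ) : ℝ :=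
  ∑ i, ∑ j, v i * w j * formEntry M i j

/-- The standard bilinear form is positive definite. -/
def IsPosDef {B : Type*} [Fintype B] (M : CoxeterMatrix B) : Prop :=
  ∀ v : B → ℝ, v ≠ 0 → 0 < bilin M v v

/-- The standard bilinear form is positive semidefinite. -/
def IsPosSemidef {B : Type*} [Fintype B] (M : CoxeterMatrix B) : Prop :=
  ∀ v : B → ℝ, 0 ≤ bilin M v v

/-- The Coxeter graph: vertices are the elements of `B`, and `i ≠ j` are adjacent
iff `m i j ≥ 3` (including `m i j = ∞`, encoded as `0`), i.e. iff `m i j ≠ 2`. -/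
def coxeterGraph {B : Type*} (M : CoxeterMatrix B) : SimpleGraph B :=
  SimpleGraph.fromRel fun i j => M i j ≠ 2

/-- A Coxeter matrix (system) is irreducible if its Coxeter graph is connected. -/
def IsIrreducible {B : Type*} (M : CoxeterMatrix B) : Prop := (coxeterGraph M).Connected

section Form

variable {B : Type*} [Fintype B] [DecidableEq B] (M : CoxeterMatrix B)

/-- The standard bilinear form, bundled. -/
noncomputable def form : LinearMap.BilinForm ℝ (B → ℝ) :=
  Matrix.toBilin' (Matrix.of (formEntry M))

theorem form_apply_self (v : B → ℝ) : form M v v = bilin M v v := by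
  simp only [form, Matrix.toBilin'_apply, bilin, Matrix.of_apply]
  exact Finset.sum_congr rfl fun i _ => Finset.sum_congr rfl fun j _ => by ring

/-- The simple root `α_i`. -/
def root (i : B) : B → ℝ := Pi.single i 1

theorem form_root_root (i j : B) : form M (root i) (root j) = formEntry M i j := by
  simp [form, root]

omit [Fintype B] [DecidableEq B] in
theorem formEntry_symm (i j : B) : formEntry M i j = formEntry M j i := by
  simp [formEntry, M.symmetric i j]

omit [Fintype B] [DecidableEq B] in
theorem formEntry_self (i : B) : formEntry M i i = 1 := by
  simp [formEntry]

omit [Fintype B] [DecidableEq B] in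
theorem two_le_of_ne {i j : B} (hij : i ≠ j) (h : M i j ≠ 0) : 2 ≤ M i j := by
  have := M.off_diagonal i j hij
  omega

omit [Fintype B] [DecidableEq B] in
theorem neg_one_le_formEntry (i j : B) : -1 ≤ formEntry M i j := by
  unfold formEntry
  split_ifs
  · exact le_rfl
  · exact neg_le_neg (Real.cos_le_one _)

omit [Fintype B] [DecidableEq B] in
theorem formEntry_nonpos {i j : B} (hij : i ≠ j) : formEntry M i j ≤ 0 := by
  unfold formEntry
  split_ifs with h
  · norm_num
  · have h2 : (2 : ℝ) ≤ M i j := by exact_mod_cast two_le_of_ne M hij h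
    refine neg_nonpos.2 (Real.cos_nonneg_of_neg_pi_div_two_le_of_le ?_ ?_)
    · have : 0 ≤ Real.pi / M i j := by positivity
      linarith [Real.pi_pos]
    · exact div_le_div_of_nonneg_left Real.pi_pos.le two_pos h2

omit [Fintype B] [DecidableEq B] in
theorem formEntry_ne_zero_of_adj {i j : B} (h : (coxeterGraph M).Adj i j) :
    formEntry M i j ≠ 0 := by
  rw [coxeterGraph, SimpleGraph.fromRel_adj, M.symmetric j i, or_self] at h
  obtain ⟨hij, h2⟩ := h
  unfold formEntry
  split_ifs with h0
  · norm_num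
  · have h3 : (2 : ℝ) < M i j := by
      have := two_le_of_ne M hij h0
      exact_mod_cast (by omega : 2 < M i j)
    refine neg_ne_zero.2 (Real.cos_pos_of_mem_Ioo ⟨?_, ?_⟩).ne'
    · have : 0 ≤ Real.pi / M i j := by positivity
      linarith [Real.pi_pos]
    · exact div_lt_div_of_pos_left Real.pi_pos two_pos h3

theorem sum_smul_root (v : B → ℝ) : ∑ i, v i • root i = v := by
  ext j
  simp [root, Pi.single_apply]

theorem form_comm (v w : B → ℝ) : form M v w = form M w v := by
  simp only [form, Matrix.toBilin'_apply, Matrix.of_apply]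
  rw [Finset.sum_comm]
  refine Finset.sum_congr rfl fun i _ => Finset.sum_congr rfl fun j _ => ?_
  rw [formEntry_symm M j i]
  ring

theorem form_root_self (i : B) : form M (root i) (root i) = 1 := by
  rw [form_root_root, formEntry_self]

theorem mem_ker_form {v : B → ℝ} :
    v ∈ LinearMap.ker (form M) ↔ ∀ i, form M v (root i) = 0 := by
  refine ⟨fun h i => by rw [LinearMap.mem_ker.1 h, LinearMap.zero_apply], fun h => ?_⟩
  rw [LinearMap.mem_ker]
  ext w
  simp [root] at *
  exact h w

theorem form_eq_zero_of_mem_ker {v : B → ℝ} (hv : v ∈ LinearMap.ker (form M)) (w : B → ℝ) :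
    form M w v = 0 := by
  rw [form_comm, LinearMap.mem_ker.1 hv, LinearMap.zero_apply]

theorem two_smul_form_root_self (i : B) : ((2 : ℝ) • form M (root i)) (root i) = 2 := by
  simp [form_root_self]

/-- The reflection in the simple root `α_i`. -/
noncomputable def simpleReflection (i : B) : (B → ℝ) ≃ₗ[ℝ] (B → ℝ) :=
  Module.reflection (two_smul_form_root_self M i)

theorem simpleReflection_apply (i : B) (v : B → ℝ) :
    simpleReflection M i v = v - (2 * form M (root i) v) • root i := by
  simp [simpleReflection, Module.reflection_apply]

open Polynomial.Chebyshev in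
theorem isLiftable_simpleReflection : M.IsLiftable (simpleReflection M) := by
  intro i j
  rcases eq_or_ne i j with rfl | hij
  · rw [M.diagonal, pow_one]
    ext1 v
    exact Module.involutive_reflection _ v
  rcases eq_or_ne (M i j) 0 with h0 | h0
  · rw [h0, pow_zero]
  have h2 := two_le_of_ne M hij h0
  ext1 v
  set m := M i j with hm
  set φ : ℝ := 2 * (Real.pi / m) with hφ
  have ht : 2 * Real.cos φ = ((2 : ℝ) • form M (root i)) (root j) *
      ((2 : ℝ) • form M (root j)) (root i) - 2 := by
    rw [LinearMap.smul_apply, LinearMap.smul_apply, form_comm M (root j), form_root_root,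
      formEntry, if_neg h0, hφ, Real.cos_two_mul]
    simp only [smul_eq_mul]
    ring
  rw [simpleReflection, simpleReflection,
    Module.reflection_mul_reflection_pow_apply _ _ _ _ _ ht]
  rcases h2.eq_or_lt with h2 | h3
  · have hc : 2 * Real.cos φ = -2 := by
      rw [hφ, ← h2]
      push_cast
      rw [mul_div_cancel₀ _ two_ne_zero, Real.cos_pi]
      norm_num
    have hz : form M (root i) (root j) = 0 := by
      rw [form_root_root, formEntry, if_neg h0, ← hm, ← h2]
      simp
    rw [← h2, hc]
    norm_num [form_comm M (root j) (root i), hz]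
    abel
  · have hmpos : (0 : ℝ) < m := by positivity
    have hs : Real.sin φ ≠ 0 := by
      refine (Real.sin_pos_of_pos_of_lt_pi (by positivity) ?_).ne'
      have : (2 : ℝ) < m := by exact_mod_cast h3
      rw [hφ, ← mul_div_assoc, div_lt_iff₀ hmpos]
      nlinarith [Real.pi_pos]
    have hS (n : ℤ) := S_two_mul_real_cos φ n
    have h1 : (S ℝ (((m : ℤ) - 2) / 2)).eval (2 * Real.cos φ) *
        ((S ℝ (((m : ℤ) - 1) / 2)).eval (2 * Real.cos φ) +
          (S ℝ (((m : ℤ) - 3) / 2)).eval (2 * Real.cos φ)) = 0 ∧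
        (S ℝ (((m : ℤ) - 1) / 2)).eval (2 * Real.cos φ) *
        ((S ℝ ((m : ℤ) / 2)).eval (2 * Real.cos φ) +
          (S ℝ (((m : ℤ) - 2) / 2)).eval (2 * Real.cos φ)) = 0 := by
      obtain ⟨k, hk | hk⟩ := Nat.even_or_odd' m
      · rw [show ((m : ℤ) - 2) / 2 = k - 1 by omega, show ((m : ℤ) - 1) / 2 = k - 1 by omega]
        have : (S ℝ ((k : ℤ) - 1)).eval (2 * Real.cos φ) = 0 := by
          refine (mul_eq_zero.1 ((hS _).trans ?_)).resolve_right hs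
          rw [show (((k : ℤ) - 1 : ℤ) + 1 : ℝ) * φ = Real.pi by
            push_cast
            rw [hφ]
            field_simp
            rw [hk]
            push_cast
            ring]
          exact Real.sin_pi
        simp [this]
      · rw [show ((m : ℤ) - 2) / 2 = k - 1 by omega, show ((m : ℤ) - 1) / 2 = k by omega,
          show ((m : ℤ) - 3) / 2 = k - 1 by omega, show (m : ℤ) / 2 = k by omega]
        have : (S ℝ (k : ℤ)).eval (2 * Real.cos φ) +
            (S ℝ ((k : ℤ) - 1)).eval (2 * Real.cos φ) = 0 := by
          refine (mul_eq_zero.1 (?_ : _ * Real.sin φ = 0)).resolve_right hs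
          rw [add_mul, hS, hS]
          rw [show (((k : ℤ) : ℝ) + 1) * φ = 2 * Real.pi - (((k : ℤ) - 1 : ℤ) + 1 : ℝ) * φ by
            push_cast
            rw [hφ]
            field_simp
            rw [hk]
            push_cast
            ring, Real.sin_two_pi_sub]
          ring
        simp [this]
    rw [h1.1, h1.2]
    simp

end Form

section GeometricRepresentation

variable {B W : Type*} [Fintype B] [DecidableEq B] [Group W] {M : CoxeterMatrix B}
  (cs : CoxeterSystem M W)

/-- The geometric representation of a Coxeter group. -/
noncomputable def geomRep : W →* ((B → ℝ) ≃ₗ[ℝ] (B → ℝ)) :=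
  cs.lift ⟨simpleReflection M, isLiftable_simpleReflection M⟩

theorem geomRep_simple (i : B) (v : B → ℝ) :
    geomRep cs (cs.simple i) v = v - (2 * form M (root i) v) • root i := by
  rw [geomRep, cs.lift_apply_simple (isLiftable_simpleReflection M), simpleReflection_apply]

theorem geomRep_mul_apply (w w' : W) (v : B → ℝ) :
    geomRep cs (w * w') v = geomRep cs w (geomRep cs w' v) := by
  rw [map_mul, LinearEquiv.mul_apply]

theorem geomRep_simple_root (i : B) : geomRep cs (cs.simple i) (root i) = -root i := by
  rw [geomRep_simple, form_root_self, mul_one, two_smul]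
  abel

theorem geomRep_simple_simple (i : B) (v : B → ℝ) :
    geomRep cs (cs.simple i) (geomRep cs (cs.simple i) v) = v := by
  rw [← geomRep_mul_apply, cs.simple_mul_simple_self, map_one, LinearEquiv.coe_one, id]

theorem form_geomRep (w : W) (v v' : B → ℝ) :
    form M (geomRep cs w v) (geomRep cs w v') = form M v v' := by
  induction w using cs.simple_induction_left generalizing v v' with
  | one => simp
  | mul_simple_left w i ih =>
    rw [geomRep_mul_apply, geomRep_mul_apply, ← ih v v', geomRep_simple, geomRep_simple]
    simp only [map_sub, map_smul, LinearMap.sub_apply, LinearMap.smul_apply, smul_eq_mul,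
      form_root_self, form_comm M _ (root i)]
    ring

theorem geomRep_mem_ker (w : W) {v : B → ℝ} (hv : v ∈ LinearMap.ker (form M)) :
    geomRep cs w v ∈ LinearMap.ker (form M) := by
  rw [mem_ker_form]
  intro i
  have h := form_geomRep cs w v ((geomRep cs w).symm (root i))
  rw [LinearEquiv.apply_symm_apply] at h
  rw [h, LinearMap.mem_ker.1 hv, LinearMap.zero_apply]

open Polynomial.Chebyshev

theorem geomRep_alternatingWord (i j : B) (k : ℕ) :
    geomRep cs (cs.wordProd (CoxeterSystem.alternatingWord i j k)) (root i) =
      if Even k then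
        (S ℝ (k : ℤ)).eval (-2 * formEntry M i j) • root i +
          (S ℝ ((k : ℤ) - 1)).eval (-2 * formEntry M i j) • root j
      else
        (S ℝ ((k : ℤ) - 1)).eval (-2 * formEntry M i j) • root i +
          (S ℝ (k : ℤ)).eval (-2 * formEntry M i j) • root j := by
  induction k with
  | zero => simp [CoxeterSystem.alternatingWord]
  | succ k ih =>
    rw [CoxeterSystem.alternatingWord_succ', cs.wordProd_cons, geomRep_mul_apply, ih]
    have hS : (S ℝ ((k : ℤ) + 1)).eval (-2 * formEntry M i j) =
        (-2 * formEntry M i j) * (S ℝ (k : ℤ)).eval (-2 * formEntry M i j) -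
          (S ℝ ((k : ℤ) - 1)).eval (-2 * formEntry M i j) := by
      rw [S_add_one]
      simp
    push_cast
    rw [hS, add_sub_cancel_right]
    by_cases hk : Even k
    · rw [if_pos hk, if_pos hk, if_neg (by simpa [Nat.even_add_one] using hk), geomRep_simple]
      simp only [map_add, map_smul, form_root_root, formEntry_self, formEntry_symm M j i,
        smul_eq_mul]
      module
    · rw [if_neg hk, if_neg hk, if_pos (by simpa [Nat.even_add_one] using hk), geomRep_simple]
      simp only [map_add, map_smul, form_root_root, formEntry_self, smul_eq_mul]
      module

omit [Fintype B] [DecidableEq B] in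
theorem eval_S_nonneg {i j : B} (hij : i ≠ j) {n : ℤ} (hn : 0 ≤ n + 1)
    (h : M i j ≠ 0 → n + 1 ≤ M i j) : 0 ≤ (S ℝ n).eval (-2 * formEntry M i j) := by
  have hn' : (0 : ℝ) ≤ n + 1 := by exact_mod_cast hn
  unfold formEntry
  split_ifs with h0
  · rw [show (-2 * -1 : ℝ) = 2 by norm_num, S_eval_two]
    exact hn'
  · have h2 : (2 : ℝ) ≤ M i j := by exact_mod_cast two_le_of_ne M hij h0
    have hm : (0 : ℝ) < M i j := by linarith
    have hle : (n + 1 : ℝ) ≤ M i j := by exact_mod_cast h h0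
    rw [neg_mul_neg]
    have hs : 0 < Real.sin (Real.pi / M i j) := by
      refine Real.sin_pos_of_pos_of_lt_pi (by positivity) ?_
      rw [div_lt_iff₀ hm]
      nlinarith [Real.pi_pos]
    refine nonneg_of_mul_nonneg_left ?_ hs
    rw [S_two_mul_real_cos]
    refine Real.sin_nonneg_of_nonneg_of_le_pi (by positivity) ?_
    rw [← mul_div_assoc, div_le_iff₀ hm]
    nlinarith [Real.pi_pos]

/-- A Coxeter group element maps a simple root which is not one of its right descents to a
positive root. -/
theorem geomRep_root_nonneg {w : W} {i : B} (hwi : cs.length w < cs.length (w * cs.simple i)) :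
    0 ≤ geomRep cs w (root i) := by
  have root_nonneg (i : B) : 0 ≤ (root i : B → ℝ) := by
    rw [root, Pi.single_nonneg]
    exact zero_le_one
  induction hl : cs.length w using Nat.strong_induction_on generalizing w i with
  | _ l ih =>
  rcases eq_or_ne w 1 with rfl | hw
  · rw [map_one]
    exact root_nonneg i
  obtain ⟨j, hj⟩ := cs.exists_rightDescent_of_ne_one hw
  have hij : i ≠ j := by
    rintro rfl
    exact lt_asymm hwi hj
  let a (k : ℕ) : W := cs.wordProd (CoxeterSystem.alternatingWord i j k)
  let P (k : ℕ) : Prop := cs.length (w * (a k)⁻¹) + k = cs.length w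
  have ha (k : ℕ) : a (k + 1) = cs.simple (if Even k then j else i) * a k := by
    simp only [a]
    rw [CoxeterSystem.alternatingWord_succ', cs.wordProd_cons]
  have hP1 : P 1 := by
    have : a 1 = cs.simple j := by simp [a, CoxeterSystem.alternatingWord]
    simp only [P]
    rw [this, cs.inv_simple]
    exact cs.isRightDescent_iff.1 hj
  have hPle (k : ℕ) (hk : P k) : k ≤ l := by
    simp only [P] at hk
    omega
  obtain ⟨k, hk1, hkP, hkmax⟩ : ∃ k, 1 ≤ k ∧ P k ∧ ¬ P (k + 1) := by
    by_contra! hcon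
    have : ∀ k, P (k + 1) := fun k => by
      induction k with
      | zero => exact hP1
      | succ k ih => exact hcon (k + 1) (by omega) ih
    have := hPle _ (this l)
    omega
  obtain ⟨k, rfl⟩ : ∃ k', k = k' + 1 := ⟨k - 1, by omega⟩
  set v := w * (a (k + 1))⁻¹ with hv
  have hkv : cs.length v + (k + 1) = cs.length w := hkP
  have hup1 : cs.length v < cs.length (v * cs.simple (if Even k then j else i)) := by
    have h1 : v * cs.simple (if Even k then j else i) = w * (a k)⁻¹ := by
      rw [hv, ha, mul_inv_rev, cs.inv_simple]
      simp [mul_assoc]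
    have h2 := cs.length_le_length_mul_add_right w (a k)⁻¹
    have h3 := cs.length_wordProd_le (CoxeterSystem.alternatingWord i j k)
    rw [CoxeterSystem.length_alternatingWord] at h3
    rw [cs.length_inv] at h2
    rw [h1]
    change cs.length (a k) ≤ k at h3
    omega
  have hup2 : cs.length v < cs.length (v * cs.simple (if Even k then i else j)) := by
    by_contra hcon
    rcases cs.length_mul_simple v (if Even k then i else j) with h | h
    · omega
    · refine hkmax ?_
      have : w * (a (k + 1 + 1))⁻¹ = v * cs.simple (if Even k then i else j) := by
        rw [ha (k + 1), mul_inv_rev, cs.inv_simple, hv, mul_assoc]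
        by_cases hk : Even k
        · rw [if_pos hk, if_neg (by simpa [Nat.even_add_one] using hk)]
        · rw [if_neg hk, if_pos (by simpa [Nat.even_add_one] using hk)]
      simp only [P]
      rw [this]
      omega
  have hvi : 0 ≤ geomRep cs v (root i) ∧ 0 ≤ geomRep cs v (root j) := by
    by_cases hk : Even k
    · rw [if_pos hk] at hup1 hup2
      exact ⟨ih _ (by omega) hup2 rfl, ih _ (by omega) hup1 rfl⟩
    · rw [if_neg hk] at hup1 hup2
      exact ⟨ih _ (by omega) hup1 rfl, ih _ (by omega) hup2 rfl⟩
  have hw' : w = v * a (k + 1) := by simp [hv]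
  have hkM : M i j ≠ 0 → k + 2 ≤ M i j := by
    intro h0
    by_contra! hlt
    refine cs.not_isReduced_alternatingWord j i (m := k + 1 + 1)
      (by rwa [M.symmetric]) (by rw [M.symmetric]; omega) ?_
    rw [CoxeterSystem.IsReduced, CoxeterSystem.alternatingWord_succ, cs.wordProd_concat,
      List.length_concat, CoxeterSystem.length_alternatingWord]
    have h1 := cs.length_mul_le v (a (k + 1) * cs.simple i)
    have h2 := cs.length_mul_le (a (k + 1)) (cs.simple i)
    have h3 := cs.length_wordProd_le (CoxeterSystem.alternatingWord i j (k + 1))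
    rw [CoxeterSystem.length_alternatingWord] at h3
    rw [← mul_assoc, ← hw'] at h1
    rw [cs.length_simple] at h2
    change cs.length (a (k + 1) * cs.simple i) = _
    change cs.length (a (k + 1)) ≤ _ at h3
    omega
  have hS1 : 0 ≤ (S ℝ ((k + 1 : ℕ) : ℤ)).eval (-2 * formEntry M i j) :=
    eval_S_nonneg hij (by omega) fun h0 => by have := hkM h0; omega
  have hS2 : 0 ≤ (S ℝ (((k + 1 : ℕ) : ℤ) - 1)).eval (-2 * formEntry M i j) :=
    eval_S_nonneg hij (by omega) fun h0 => by have := hkM h0; omega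
  rw [hw', geomRep_mul_apply, geomRep_alternatingWord]
  split_ifs
  · rw [map_add, map_smul, map_smul]
    exact add_nonneg (smul_nonneg hS1 hvi.1) (smul_nonneg hS2 hvi.2)
  · rw [map_add, map_smul, map_smul]
    exact add_nonneg (smul_nonneg hS2 hvi.1) (smul_nonneg hS1 hvi.2)

theorem geomRep_root_nonpos {w : W} {i : B} (hwi : cs.IsRightDescent w i) :
    geomRep cs w (root i) ≤ 0 := by
  have h : 0 ≤ geomRep cs (w * cs.simple i) (root i) := by
    refine geomRep_root_nonneg cs ?_
    rwa [cs.simple_mul_simple_cancel_right]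
  rw [geomRep_mul_apply, geomRep_simple_root, map_neg] at h
  exact neg_nonneg.1 h

omit [Fintype B] in
theorem not_root_nonpos (i : B) : ¬ (root i : B → ℝ) ≤ 0 := fun h => by
  have := h i
  simp [root] at this
  linarith

theorem eq_one_of_geomRep_root_eq {w : W} (hw : ∀ i, geomRep cs w (root i) = root i) :
    w = 1 := by
  by_contra hne
  obtain ⟨i, hi⟩ := cs.exists_rightDescent_of_ne_one hne
  have := geomRep_root_nonpos cs hi
  rw [hw i] at this
  exact not_root_nonpos i this

theorem finite_of_geomRep_root_eq_neg {w : W} (hw : ∀ i, geomRep cs w (root i) = -root i) :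
    Finite W := by
  have hneg (v : B → ℝ) : geomRep cs w v = -v := by
    rw [← sum_smul_root v]
    simp [hw]
  have hlen (n : ℕ) : ∀ u, cs.length u = n → cs.length (w * u) + n = cs.length w := by
    induction n with
    | zero =>
      intro u hu
      rw [cs.length_eq_zero_iff.1 hu, mul_one, add_zero]
    | succ n ih =>
      intro u hu
      have hu1 : u ≠ 1 := by
        rintro rfl
        simp at hu
      obtain ⟨i, hi⟩ := cs.exists_rightDescent_of_ne_one hu1
      have hui := cs.isRightDescent_iff.1 hi
      have h1 := ih (u * cs.simple i) (by omega)
      have h2 : cs.length (w * u) + 1 = cs.length (w * (u * cs.simple i)) := by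
        rcases cs.length_mul_simple (w * (u * cs.simple i)) i with h | h
        · have hu' : 0 ≤ geomRep cs (u * cs.simple i) (root i) := by
            refine geomRep_root_nonneg cs ?_
            rw [cs.simple_mul_simple_cancel_right]
            exact hi
          have hwu := geomRep_root_nonneg cs (Nat.lt_of_succ_le h.ge)
          rw [geomRep_mul_apply, hneg] at hwu
          have h0 := le_antisymm (neg_nonneg.1 hwu) hu'
          rw [LinearEquiv.map_eq_zero_iff] at h0
          exact absurd h0.le (not_root_nonpos i)
        · rwa [← mul_assoc, cs.simple_mul_simple_cancel_right, mul_assoc] at h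
      omega
  have hfin : {ω : List B | ω.length ≤ cs.length w}.Finite := List.finite_length_le B _
  refine Set.finite_univ_iff.1 ((hfin.image cs.wordProd).subset fun u _ => ?_)
  obtain ⟨ω, hω, rfl⟩ := cs.exists_isReduced u
  refine ⟨ω, ?_, rfl⟩
  have := hlen _ _ hω
  change ω.length ≤ _
  omega

end GeometricRepresentation

section RankTwo

variable {B : Type*} [Fintype B] [DecidableEq B] (M : CoxeterMatrix B)

variable {M} in
omit [Fintype B] [DecidableEq B] in
theorem IsIrreducible.induction (hirr : IsIrreducible M) {P : B → Prop} {i : B} (hi : P i)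
    (step : ∀ i j, (coxeterGraph M).Adj i j → P i → P j) (j : B) : P j := by
  obtain ⟨p⟩ := hirr.preconnected i j
  induction p with
  | nil => exact hi
  | cons h _ ih => exact ih (step _ _ h hi)

theorem eq_top_of_root_mem {X : Submodule ℝ (B → ℝ)} (h : ∀ i, root i ∈ X) : X = ⊤ := by
  refine eq_top_iff.2 fun v _ => ?_
  rw [← sum_smul_root v]
  exact X.sum_mem fun i _ => X.smul_mem _ (h i)

theorem gram_eq_zero {β γ : B → ℝ}
    (h : ∀ v, form M β v = 0 → form M γ v = 0 → v ∈ LinearMap.ker (form M)) (a b c : B → ℝ) :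
    form M a a * form M b b * form M c c + 2 * form M a b * form M b c * form M a c
      - form M a a * form M b c ^ 2 - form M b b * form M a c ^ 2
      - form M c c * form M a b ^ 2 = 0 := by
  let f : (Fin 3 → ℝ) →ₗ[ℝ] (B → ℝ) := Fintype.linearCombination ℝ ![a, b, c]
  let g : (Fin 3 → ℝ) →ₗ[ℝ] ℝ × ℝ := ((form M β).prod (form M γ)) ∘ₗ f
  have hg : LinearMap.ker g ≠ ⊥ := LinearMap.ker_ne_bot_of_finrank_lt (by simp)
  obtain ⟨x, hx, hx0⟩ := (Submodule.ne_bot_iff _).1 hg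
  have hx' : form M β (f x) = 0 ∧ form M γ (f x) = 0 := by
    simpa [g, Prod.ext_iff] using hx
  have hk := h _ hx'.1 hx'.2
  have hf : f x = x 0 • a + x 1 • b + x 2 • c := by
    simp [f, Fintype.linearCombination_apply, Fin.sum_univ_three]
  have hdet : (!![form M a a, form M a b, form M a c;
      form M a b, form M b b, form M b c;
      form M a c, form M b c, form M c c]).det = 0 := by
    refine Matrix.exists_mulVec_eq_zero_iff.1 ⟨x, hx0, ?_⟩
    have h1 := form_eq_zero_of_mem_ker M hk a
    have h2 := form_eq_zero_of_mem_ker M hk b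
    have h3 := form_eq_zero_of_mem_ker M hk c
    rw [hf] at h1 h2 h3
    simp only [map_add, map_smul, smul_eq_mul, form_comm M b a, form_comm M c a,
      form_comm M c b] at h1 h2 h3
    ext i
    fin_cases i <;> simp [Matrix.mulVec, dotProduct, Fin.sum_univ_three] <;> linarith
  rw [Matrix.det_fin_three] at hdet
  simp at hdet
  linarith

/-- If the form has rank at most two, it is positive semidefinite. -/
theorem isPosSemidef_of_rank_le_two {β γ : B → ℝ}
    (h : ∀ v, form M β v = 0 → form M γ v = 0 → v ∈ LinearMap.ker (form M)) :
    IsPosSemidef M := by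
  intro v
  by_contra! hv
  rw [← form_apply_self] at hv
  have hgram := gram_eq_zero M h
  have hneg (i j : B) (hij : i ≠ j) : formEntry M i j = -1 := by
    by_contra hne
    have h1 := lt_of_le_of_ne (neg_one_le_formEntry M i j) (Ne.symm hne)
    have h2 := formEntry_nonpos M hij
    have h3 := hgram (root i) (root j) v
    simp only [form_root_root, formEntry_self] at h3
    have h4 : 0 < 1 - formEntry M i j ^ 2 := by nlinarith
    nlinarith [sq_nonneg (form M (root i) v - formEntry M i j * form M (root j) v),
      mul_pos (neg_pos.2 hv) h4, mul_nonneg (sq_nonneg (form M (root j) v)) h4.le]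
  rcases isEmpty_or_nonempty B with hB | ⟨⟨i⟩⟩
  · simp [form_apply_self, bilin] at hv
  have htop : LinearMap.ker (form M) ⊔ Submodule.span ℝ {root i} = ⊤ := by
    refine eq_top_of_root_mem fun j => ?_
    have hi : root i ∈ LinearMap.ker (form M) ⊔ Submodule.span ℝ {root i} :=
      Submodule.mem_sup_right (Submodule.mem_span_singleton_self _)
    rcases eq_or_ne i j with rfl | hij
    · exact hi
    · have hk : root i + root j ∈ LinearMap.ker (form M) := by
        rw [mem_ker_form]
        intro k
        rw [map_add, LinearMap.add_apply, form_root_root, form_root_root]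
        rcases eq_or_ne i k with rfl | hik
        · rw [formEntry_self, hneg j i hij.symm]
          norm_num
        rcases eq_or_ne j k with rfl | hjk
        · rw [formEntry_self, hneg i j hij]
          norm_num
        have := hgram (root i) (root j) (root k)
        simp only [form_root_root, formEntry_self, hneg i j hij, hneg i k hik,
          hneg j k hjk] at this
        norm_num at this
      have := Submodule.sub_mem _ (Submodule.mem_sup_left hk) hi
      rwa [add_sub_cancel_left] at this
  have hmem : v ∈ LinearMap.ker (form M) ⊔ Submodule.span ℝ {root i} := by
    rw [htop]
    exact Submodule.mem_top
  obtain ⟨r, hr, y, hy, rfl⟩ := Submodule.mem_sup.1 hmem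
  obtain ⟨c, rfl⟩ := Submodule.mem_span_singleton.1 hy
  simp only [map_add, LinearMap.add_apply, LinearMap.mem_ker.1 hr, form_eq_zero_of_mem_ker M hr,
    map_smul, LinearMap.smul_apply, form_root_self, smul_eq_mul, LinearMap.zero_apply] at hv
  nlinarith [mul_self_nonneg c]

end RankTwo

section FiniteIndex

variable {B W : Type*} [Fintype B] [DecidableEq B] [Group W] {M : CoxeterMatrix B}
  (cs : CoxeterSystem M W)

/-- A subspace invariant under the Coxeter group is either everything or contained in the
radical. -/
theorem eq_top_of_invariant (hirr : IsIrreducible M) {X : Submodule ℝ (B → ℝ)}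
    (hX : ∀ i, ∀ x ∈ X, geomRep cs (cs.simple i) x ∈ X)
    (hk : ¬ X ≤ LinearMap.ker (form M)) : X = ⊤ := by
  have key (i : B) (x : B → ℝ) (hx : x ∈ X) (h : form M (root i) x ≠ 0) : root i ∈ X := by
    have := X.sub_mem hx (hX i x hx)
    rw [geomRep_simple, sub_sub_cancel] at this
    exact (X.smul_mem_iff (mul_ne_zero two_ne_zero h)).1 this
  obtain ⟨x, hx, hxk⟩ := Set.not_subset.1 hk
  rw [SetLike.mem_coe, mem_ker_form] at hxk
  push Not at hxk
  obtain ⟨i, hi⟩ := hxk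
  refine eq_top_of_root_mem (hirr.induction (key i x hx (by rwa [form_comm])) ?_)
  intro j k hjk hj
  refine key k _ hj ?_
  rw [form_root_root]
  exact formEntry_ne_zero_of_adj M hjk.symm

/-- An invariant symmetric form, given as a sum of products of linear forms, is a multiple of the
standard one. -/
theorem form_proportional (hirr : IsIrreducible M) (Q : LinearMap.BilinForm ℝ (B → ℝ))
    (hsymm : ∀ v w, Q v w = Q w v)
    (hQ : ∀ i v w, Q (geomRep cs (cs.simple i) v) (geomRep cs (cs.simple i) w) = Q v w) (i : B) :
    Q = Q (root i) (root i) • form M := by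
  have h1 (j : B) (v : B → ℝ) : Q (root j) v = form M (root j) v * Q (root j) (root j) := by
    have := hQ j (root j) v
    rw [geomRep_simple_root, geomRep_simple] at this
    simp only [map_neg, LinearMap.neg_apply, map_sub, map_smul, smul_eq_mul] at this
    linarith
  have h2 (j : B) : Q (root j) (root j) = Q (root i) (root i) := by
    refine hirr.induction (P := fun j => Q (root j) (root j) = Q (root i) (root i)) rfl ?_ j
    intro j k hjk hj
    rw [← hj]
    have := hsymm (root j) (root k)
    rw [h1 j, h1 k, form_comm M (root k)] at this
    refine (mul_left_cancel₀ ?_ this).symm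
    rw [form_root_root]
    exact formEntry_ne_zero_of_adj M hjk
  refine (Pi.basisFun ℝ B).ext fun j => LinearMap.ext fun w => ?_
  rw [Pi.basisFun_apply]
  change Q (root j) w = Q (root i) (root i) * form M (root j) w
  rw [h1, h2, mul_comm]

/-- `x` is, modulo the radical, a common eigenvector of `N` outside the radical. -/
def IsEigenvector (N : Subgroup W) (x : B → ℝ) : Prop :=
  x ∉ LinearMap.ker (form M) ∧
    ∀ n ∈ N, ∃ c : ℝ, geomRep cs n x - c • x ∈ LinearMap.ker (form M)

theorem isPosSemidef_of_sq_eq_one (hirr : IsIrreducible M) {N : Subgroup W} [N.FiniteIndex]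
    {x : B → ℝ} (hx : x ∉ LinearMap.ker (form M))
    (h : ∀ n ∈ N, ∃ c : ℝ, c ^ 2 = 1 ∧ geomRep cs n x - c • x ∈ LinearMap.ker (form M)) :
    IsPosSemidef M := by
  let L (w : W) : (B → ℝ) →ₗ[ℝ] ℝ := form M (geomRep cs w x)
  have hL (w n : W) (hn : n ∈ N) (v v' : B → ℝ) : L (w * n) v * L (w * n) v' = L w v * L w v' := by
    obtain ⟨c, hc, hcx⟩ := h n hn
    have : L (w * n) = c • L w := by
      have := LinearMap.mem_ker.1 (geomRep_mem_ker cs w hcx)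
      rw [map_sub, map_smul, map_sub, map_smul, sub_eq_zero] at this
      simp only [L]
      rw [geomRep_mul_apply, this]
    rw [this]
    simp only [LinearMap.smul_apply, smul_eq_mul]
    linear_combination (L w v * L w v') * hc
  have : Fintype (W ⧸ N) := Fintype.ofFinite _
  let Q : LinearMap.BilinForm ℝ (B → ℝ) := ∑ q : W ⧸ N, (L q.out).smulRight (L q.out)
  have hQ (v v' : B → ℝ) : Q v v' = ∑ q : W ⧸ N, L q.out v * L q.out v' := by
    simp [Q, LinearMap.sum_apply]
  have hsymm (v w : B → ℝ) : Q v w = Q w v := by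
    simp only [hQ, mul_comm]
  have hinv (g : W) (v v' : B → ℝ) : Q (geomRep cs g v) (geomRep cs g v') = Q v v' := by
    rw [hQ, hQ, ← Equiv.sum_comp (MulAction.toPerm g)]
    refine Finset.sum_congr rfl fun q _ => ?_
    obtain ⟨n, hn⟩ := QuotientGroup.mk_out_eq_mul N (g * q.out)
    have hgq : (g • q : W ⧸ N) = ((g * q.out : W) : W ⧸ N) := by
      conv_lhs => rw [← q.out_eq']
      rfl
    rw [MulAction.toPerm_apply, hgq, hn, hL _ _ n.2]
    simp only [L, geomRep_mul_apply, form_geomRep]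
  obtain ⟨i⟩ := hirr.nonempty
  have hQi := form_proportional cs hirr Q hsymm (fun i => hinv _) i
  have hnn (v : B → ℝ) : 0 ≤ Q v v := by
    rw [hQ]
    exact Finset.sum_nonneg fun q _ => mul_self_nonneg _
  have hpos : 0 < Q (root i) (root i) := by
    refine (hnn _).lt_of_ne' fun h0 => hx ?_
    rw [h0, zero_smul] at hQi
    rw [mem_ker_form]
    intro j
    have h1 := hQ (root j) (root j)
    rw [hQi, LinearMap.zero_apply, LinearMap.zero_apply, eq_comm,
      Finset.sum_eq_zero_iff_of_nonneg fun q _ => mul_self_nonneg _] at h1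
    have h2 := h1 ((1 : W) : W ⧸ N) (Finset.mem_univ _)
    obtain ⟨n, hn⟩ := QuotientGroup.mk_out_eq_mul N (1 : W)
    rw [hn, hL _ _ n.2, mul_self_eq_zero] at h2
    simpa [L] using h2
  intro v
  have := hnn v
  rw [hQi, LinearMap.smul_apply, LinearMap.smul_apply, form_apply_self, smul_eq_mul] at this
  exact nonneg_of_mul_nonneg_right this hpos

variable {cs}

theorem IsEigenvector.map {N : Subgroup W} [hN : N.Normal] {x : B → ℝ} (hx : IsEigenvector cs N x)
    (w : W) : IsEigenvector cs N (geomRep cs w x) := by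
  refine ⟨fun h => hx.1 ?_, fun n hn => ?_⟩
  · have := geomRep_mem_ker cs w⁻¹ h
    rwa [← geomRep_mul_apply, inv_mul_cancel, map_one] at this
  · obtain ⟨c, hc⟩ := hx.2 (w⁻¹ * n * w) (by simpa using hN.conj_mem n hn w⁻¹)
    refine ⟨c, ?_⟩
    have := geomRep_mem_ker cs w hc
    rwa [map_sub, map_smul, ← geomRep_mul_apply, ← mul_assoc, mul_inv_cancel_left,
      geomRep_mul_apply] at this

theorem form_eq_of_eigen {n : W} {u v : B → ℝ} {p q : ℝ}
    (hu : geomRep cs n u - p • u ∈ LinearMap.ker (form M))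
    (hv : geomRep cs n v - q • v ∈ LinearMap.ker (form M)) :
    form M u v = p * q * form M u v := by
  have h1 := LinearMap.mem_ker.1 hu
  rw [map_sub, sub_eq_zero] at h1
  have h2 := form_eq_zero_of_mem_ker M hv u
  rw [map_sub, sub_eq_zero] at h2
  conv_lhs => rw [← form_geomRep cs n, h1]
  rw [map_smul, LinearMap.smul_apply, h2, map_smul, smul_eq_mul, smul_eq_mul, mul_assoc]

theorem IsEigenvector.formEntry_eq {N : Subgroup W} [N.Normal] {x : B → ℝ}
    (hx : IsEigenvector cs N x) {n : W} (hn : n ∈ N) {c : ℝ} (hc : c ^ 2 ≠ 1)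
    (hnx : geomRep cs n x - c • x ∈ LinearMap.ker (form M)) {i j : B} (hij : i ≠ j)
    (hi : form M x (root i) ≠ 0) (hj : form M x (root j) ≠ 0) :
    formEntry M i j = -1 ∧ form M x (root i) = -form M x (root j) := by
  have hxx : form M x x = 0 := by
    by_contra h
    have := form_eq_of_eigen hnx hnx
    exact hc (by rw [sq]; exact (mul_eq_right₀ h).1 this.symm)
  have hmul (k : B) (hk : form M x (root k) ≠ 0) (d : ℝ)
      (hd : geomRep cs n (geomRep cs (cs.simple k) x) - d • geomRep cs (cs.simple k) x ∈
        LinearMap.ker (form M)) : c * d = 1 := by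
    have h := form_eq_of_eigen hnx hd
    refine (mul_eq_right₀ ?_).1 h.symm
    rw [geomRep_simple, map_sub, map_smul, hxx, form_comm M (root k)]
    simpa using hk
  obtain ⟨d, hd⟩ := (hx.map (cs.simple i)).2 n hn
  obtain ⟨e, he⟩ := (hx.map (cs.simple j)).2 n hn
  have hcd := hmul i hi d hd
  have hce := hmul j hj e he
  have h0 : form M (geomRep cs (cs.simple i) x) (geomRep cs (cs.simple j) x) = 0 := by
    by_contra h
    have hde := (mul_eq_right₀ h).1 (form_eq_of_eigen hd he).symm
    refine hc ?_
    linear_combination (-c ^ 2) * hde + c * d * hce + hcd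
  rw [geomRep_simple, geomRep_simple] at h0
  simp only [map_sub, map_smul, LinearMap.sub_apply, LinearMap.smul_apply, smul_eq_mul, hxx,
    form_comm M (root _) x, form_root_root] at h0
  have h1 := neg_one_le_formEntry M i j
  have h2 := formEntry_nonpos M hij
  set a := form M x (root i)
  set b := form M x (root j)
  set k := formEntry M i j
  have h3 : (a - k * b) ^ 2 + b ^ 2 * (1 - k ^ 2) = 0 := by linear_combination (-1 / 2) * h0
  have h4 : 0 ≤ b ^ 2 * (1 - k ^ 2) := mul_nonneg (sq_nonneg _) (by nlinarith)
  have h5 : b ^ 2 * (1 - k ^ 2) = 0 := by nlinarith [sq_nonneg (a - k * b)]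
  have h6 : k = -1 := by
    have := (mul_eq_zero.1 h5).resolve_left (pow_ne_zero 2 hj)
    nlinarith
  refine ⟨h6, ?_⟩
  rw [h5, add_zero, h6] at h3
  have := pow_eq_zero_iff two_ne_zero |>.1 h3
  linarith

theorem IsEigenvector.isPosSemidef (hirr : IsIrreducible M) {N : Subgroup W} [hN : N.Normal]
    [N.FiniteIndex] {x : B → ℝ} (hx : IsEigenvector cs N x) : IsPosSemidef M := by
  by_cases hsq : ∀ n ∈ N, ∀ c : ℝ,
      geomRep cs n x - c • x ∈ LinearMap.ker (form M) → c ^ 2 = 1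
  · refine isPosSemidef_of_sq_eq_one cs hirr (N := N) hx.1 fun n hn => ?_
    obtain ⟨c, hc⟩ := hx.2 n hn
    exact ⟨c, hsq n hn c hc, hc⟩
  push Not at hsq
  obtain ⟨n, hn, c, hnx, hc⟩ := hsq
  have hpair {i j : B} := hx.formEntry_eq hn hc hnx (i := i) (j := j)
  have hx1 := hx.1
  rw [mem_ker_form] at hx1
  push Not at hx1
  obtain ⟨s, hs⟩ := hx1
  have hall : ∀ i, form M x (root i) ≠ 0 := by
    refine hirr.induction hs ?_
    intro i j hij hi hj
    have hk := formEntry_ne_zero_of_adj M hij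
    have hy (k : B) : form M (geomRep cs (cs.simple i) x) (root k) =
        form M x (root k) - 2 * form M x (root i) * formEntry M i k := by
      rw [geomRep_simple]
      simp [form_root_root, form_comm M (root i) x]
    have hny : geomRep cs (cs.simple i * n * (cs.simple i)⁻¹) (geomRep cs (cs.simple i) x) -
        c • geomRep cs (cs.simple i) x ∈ LinearMap.ker (form M) := by
      have := geomRep_mem_ker cs (cs.simple i) hnx
      rwa [← geomRep_mul_apply, inv_mul_cancel_right, geomRep_mul_apply, ← map_smul, ← map_sub]
    obtain ⟨h1, h2⟩ := (hx.map (cs.simple i)).formEntry_eq (hN.conj_mem n hn _) hc hny hij.ne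
      (by
        rw [hy, formEntry_self]
        intro h
        exact hi (by linarith))
      (by
        rw [hy, hj, zero_sub, neg_ne_zero]
        exact mul_ne_zero (mul_ne_zero two_ne_zero hi) hk)
    rw [hy, hy, hj, formEntry_self, h1] at h2
    exact hi (by linarith)
  refine isPosSemidef_of_rank_le_two M (β := root s) (γ := root s) fun v hv _ => ?_
  rw [form_comm] at hv
  rw [mem_ker_form]
  intro j
  rcases eq_or_ne s j with rfl | hsj
  · exact hv
  have hk : root s + root j ∈ LinearMap.ker (form M) := by
    rw [mem_ker_form]
    intro k
    obtain ⟨h1, h2⟩ := hpair hsj (hall s) (hall j)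
    rw [map_add, LinearMap.add_apply, form_root_root, form_root_root]
    rcases eq_or_ne s k with rfl | hsk
    · rw [formEntry_self, formEntry_symm, h1]
      norm_num
    rcases eq_or_ne j k with rfl | hjk
    · rw [formEntry_self, h1]
      norm_num
    have h3 := (hpair hsk (hall s) (hall k)).2
    have h4 := (hpair hjk (hall j) (hall k)).2
    exact absurd (by linarith) (hall s)
  have := form_eq_zero_of_mem_ker M hk v
  rwa [map_add, hv, zero_add] at this

variable (cs)

/-- Modulo the radical, finite index normal subgroups act irreducibly when the form is not
positive semidefinite. -/
theorem eq_top_of_finiteIndex_invariant (hirr : IsIrreducible M) (hM : ¬ IsPosSemidef M)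
    {N : Subgroup W} [hN : N.Normal] [N.FiniteIndex] {E : Submodule ℝ (B → ℝ)}
    (hE : ∀ n ∈ N, ∀ x ∈ E, geomRep cs n x ∈ E) (hkE : LinearMap.ker (form M) ≤ E)
    (hEk : ¬ E ≤ LinearMap.ker (form M)) : E = ⊤ := by
  let S : Set (Submodule ℝ (B → ℝ)) := {X | (∀ n ∈ N, ∀ x ∈ X, geomRep cs n x ∈ X) ∧
    LinearMap.ker (form M) ≤ X ∧ ¬ X ≤ LinearMap.ker (form M) ∧ X ≤ E}
  obtain ⟨X, ⟨hXN, hkX, hXk, hXE⟩, hmin⟩ :=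
    (wellFounded_lt (α := Submodule ℝ (B → ℝ))).has_min S ⟨E, hE, hkE, hEk, le_rfl⟩
  by_cases hX : ∀ i, ∀ x ∈ X, geomRep cs (cs.simple i) x ∈ X
  · exact top_le_iff.1 (eq_top_of_invariant cs hirr hX hXk ▸ hXE)
  exfalso
  push Not at hX
  obtain ⟨i, y, hy, hyX⟩ := hX
  have hYX : X ⊓ X.comap (geomRep cs (cs.simple i)).toLinearMap < X :=
    inf_le_left.lt_of_not_ge fun h => hyX (h hy).2
  have hYk : X ⊓ X.comap (geomRep cs (cs.simple i)).toLinearMap ≤ LinearMap.ker (form M) := by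
    by_contra hcon
    refine hmin _ ⟨fun n hn x hx => Submodule.mem_inf.2 ⟨hXN n hn x hx.1, ?_⟩,
      le_inf hkX fun v hv => ?_, hcon, inf_le_left.trans hXE⟩ hYX
    · have := hXN _ (hN.conj_mem n hn (cs.simple i)) _ hx.2
      change geomRep cs _ (geomRep cs _ _) ∈ X at this
      rwa [← geomRep_mul_apply, inv_mul_cancel_right, geomRep_mul_apply] at this
    · exact hkX (geomRep_mem_ker cs _ hv)
  have horth (v : B → ℝ) (hv : v ∈ X) (h : form M (root i) v = 0) :
      v ∈ LinearMap.ker (form M) := by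
    refine hYk ⟨hv, ?_⟩
    change geomRep cs _ v ∈ X
    rwa [geomRep_simple, h, mul_zero, zero_smul, sub_zero]
  obtain ⟨x, hx, hxk⟩ := Set.not_subset.1 hXk
  have hx0 : form M (root i) x ≠ 0 := fun h => hxk (horth x hx h)
  refine hM (IsEigenvector.isPosSemidef (cs := cs) hirr (N := N) (x := x) ⟨hxk, fun n hn => ?_⟩)
  refine ⟨form M (root i) (geomRep cs n x) / form M (root i) x,
    horth _ (X.sub_mem (hXN n hn x hx) (X.smul_mem _ hx)) ?_⟩
  rw [map_sub, map_smul, smul_eq_mul, div_mul_cancel₀ _ hx0, sub_self]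

/-- An element commuting with a finite index normal subgroup maps each simple root to itself or
its negative. -/
theorem geomRep_root_eq_or_eq_neg (hirr : IsIrreducible M) (hM : ¬ IsPosSemidef M)
    {N : Subgroup W} [hN : N.Normal] [N.FiniteIndex] {z : W} (hz : ∀ n ∈ N, n * z = z * n)
    (i : B) : geomRep cs z (root i) = root i ∨ geomRep cs z (root i) = -root i := by
  by_contra! hcon
  set γ := geomRep cs z (root i) with hγ
  have hγγ : form M γ γ = 1 := by rw [hγ, form_geomRep, form_root_self]
  have hzinv (n : W) (hn : n ∈ N) : z⁻¹ * n = n * z⁻¹ := by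
    rw [inv_mul_eq_iff_eq_mul, ← mul_assoc, ← hz n hn, mul_inv_cancel_right]
  have hconj (v : B → ℝ) :
      geomRep cs (z * cs.simple i * z⁻¹) v = v - (2 * form M γ v) • γ := by
    have hv : form M (root i) (geomRep cs z⁻¹ v) = form M γ v := by
      rw [hγ, ← form_geomRep cs z, ← geomRep_mul_apply, mul_inv_cancel, map_one,
        LinearEquiv.coe_one, id]
    rw [geomRep_mul_apply, geomRep_mul_apply, geomRep_simple, hv, map_sub, map_smul,
      ← geomRep_mul_apply, mul_inv_cancel, map_one, LinearEquiv.coe_one, id]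
  let E : Submodule ℝ (B → ℝ) :=
    LinearMap.eqLocus (geomRep cs (cs.simple i * (z * cs.simple i * z⁻¹))).toLinearMap
      LinearMap.id
  have hEmem (v : B → ℝ) : v ∈ E ↔ form M (root i) v = 0 ∧ form M γ v = 0 := by
    have h1 : v ∈ E ↔ geomRep cs (z * cs.simple i * z⁻¹) v = geomRep cs (cs.simple i) v := by
      change geomRep cs _ v = v ↔ _
      rw [geomRep_mul_apply]
      refine ⟨fun h => ?_, fun h => ?_⟩
      · rw [← geomRep_simple_simple cs i (geomRep cs (z * cs.simple i * z⁻¹) v), h]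
      · rw [h, geomRep_simple_simple]
    rw [h1, hconj, geomRep_simple, sub_right_inj]
    refine ⟨fun h => ?_, fun h => by simp [h]⟩
    have hγ0 : form M γ v = 0 := by
      by_contra h0
      have h2 : γ = (form M (root i) v / form M γ v) • root i := by
        rw [div_eq_inv_mul, mul_smul, eq_inv_smul_iff₀ h0]
        rw [mul_smul, mul_smul] at h
        exact smul_right_injective _ (two_ne_zero (α := ℝ)) h
      have h3 := hγγ
      rw [h2] at h3
      simp only [map_smul, LinearMap.smul_apply, form_root_self, smul_eq_mul, mul_one] at h3
      rcases mul_self_eq_one_iff.1 h3 with h4 | h4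
      · rw [h4, one_smul] at h2
        exact hcon.1 h2
      · rw [h4, neg_one_smul] at h2
        exact hcon.2 h2
    refine ⟨?_, hγ0⟩
    rw [hγ0, mul_zero, zero_smul, eq_comm, smul_eq_zero] at h
    refine (mul_eq_zero.1 (h.resolve_right fun h0 => ?_)).resolve_left two_ne_zero
    exact not_root_nonpos i h0.le
  have hE : E = ⊤ := by
    refine eq_top_of_finiteIndex_invariant cs hirr hM (N := N) (fun n hn x hx => ?_)
      (fun v hv => ?_) fun hEk => ?_
    · change geomRep cs _ x = x at hx
      change geomRep cs _ (geomRep cs n x) = geomRep cs n x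
      have hsns : cs.simple i * n * cs.simple i ∈ N := by
        simpa using hN.conj_mem n hn (cs.simple i)
      have hcomm : cs.simple i * (z * cs.simple i * z⁻¹) * n =
          n * (cs.simple i * (z * cs.simple i * z⁻¹)) := by
        calc cs.simple i * (z * cs.simple i * z⁻¹) * n
            = cs.simple i * z * cs.simple i * (z⁻¹ * n) := by group
          _ = cs.simple i * z * (cs.simple i * n * cs.simple i) * cs.simple i * z⁻¹ := by
            rw [hzinv n hn]
            simp [mul_assoc]
          _ = cs.simple i * (cs.simple i * n * cs.simple i) * z * cs.simple i * z⁻¹ := by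
            rw [mul_assoc (cs.simple i) z, ← hz _ hsns]
            simp [mul_assoc]
          _ = _ := by simp [mul_assoc]
      rw [← geomRep_mul_apply, hcomm, geomRep_mul_apply, hx]
    · rw [hEmem]
      exact ⟨form_eq_zero_of_mem_ker M hv _, form_eq_zero_of_mem_ker M hv _⟩
    · exact hM (isPosSemidef_of_rank_le_two M fun v h1 h2 => hEk ((hEmem v).2 ⟨h1, h2⟩))
  have := ((hEmem (root i)).1 (hE ▸ Submodule.mem_top)).1
  rw [form_root_self] at this
  exact one_ne_zero this

theorem eq_one_of_commute_finiteIndex (cs : CoxeterSystem M W) (hirr : IsIrreducible M)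
    (hinf : Infinite W) (hM : ¬ IsPosSemidef M) {N : Subgroup W} [N.Normal] [N.FiniteIndex] {z : W}
    (hz : ∀ n ∈ N, n * z = z * n) : z = 1 := by
  have hsign := geomRep_root_eq_or_eq_neg cs hirr hM hz
  obtain ⟨i⟩ := hirr.nonempty
  have hstep (ε : ℝ) (hε : ε ^ 2 = 1) (hi : geomRep cs z (root i) = ε • root i) (j : B) :
      geomRep cs z (root j) = ε • root j := by
    refine hirr.induction (P := fun j => geomRep cs z (root j) = ε • root j) hi ?_ j
    intro j k hjk hj
    obtain ⟨δ, hδ⟩ : ∃ δ : ℝ, geomRep cs z (root k) = δ • root k := by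
      rcases hsign k with h | h
      · exact ⟨1, by rw [h, one_smul]⟩
      · exact ⟨-1, by rw [h, neg_one_smul]⟩
    have h1 := form_geomRep cs z (root j) (root k)
    rw [hj, hδ, form_comm] at h1
    simp only [map_smul, LinearMap.smul_apply, smul_eq_mul, form_comm M (root k),
      form_root_root] at h1
    have h2 : δ * ε = 1 := by
      refine mul_right_cancel₀ (formEntry_ne_zero_of_adj M hjk) ?_
      linarith
    have h3 : δ = ε := by linear_combination ε * h2 - δ * hε
    rw [hδ, h3]
  rcases hsign i with h | h
  · refine eq_one_of_geomRep_root_eq cs fun j => ?_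
    simpa using hstep 1 (by norm_num) (by simpa using h) j
  · have := finite_of_geomRep_root_eq_neg cs fun j => by
      simpa using hstep (-1) (by norm_num) (by simpa using h) j
    exact absurd this (not_finite_iff_infinite.2 hinf)

end FiniteIndex

/-- The center of any finite index subgroup of an irreducible,
infinite, non-affine Coxeter group is trivial. -/
theorem center_of_finiteIndex_subgroup_eq_bot
    {B W : Type*} [Fintype B] [Group W] {M : CoxeterMatrix B} (cs : CoxeterSystem M W)
    (hirr : IsIrreducible M) (hinf : Infinite W)
    (hnonaff : ¬ IsPosDef M ∧ ¬ IsPosSemidef M)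
    (G : Subgroup W) (hG : G.FiniteIndex) :
    Subgroup.center G = ⊥ := by
  classical
  refine (Subgroup.eq_bot_iff_forall _).2 fun z hz => Subtype.ext ?_
  refine eq_one_of_commute_finiteIndex cs hirr hinf hnonaff.2 (N := G.normalCore) fun n hn => ?_
  exact congrArg Subtype.val (Subgroup.mem_center_iff.1 hz ⟨n, G.normalCore_le hn⟩)

end CoxeterPaper
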